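/- Let Π be a closed and strictly positive set of distributions on {0,1}^p, let r be a quota rule and f a logical connection. There exists a constant c > 0, depending only on Π, q, d, and f, such that for every n ≥ 1 for which both condition κ1(n) and condition κ3(n) fail, DP^min(n) ≥ c·n^{−1/2}. -/

import Mathlib

/-- A judgement on `p` premises: a vector in `{0,1}^p`, encoded as `Fin p → Bool`. -/
abbrev Judg (p : ℕ) : Type := Fin p → Bool

noncomputable section

/-- `Ω_i`: for a premise index `i < p`, the set of judgements whose `i`-th premise is `1`;
for the conclusion index `i = p`, the set of judgements `ω` with `f ω = 1`. -/
def Omega (p : ℕ) (f : Judg p → Bool) (i : Fin (p + 1)) : Finset (Judg p) :=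
  if h : (i : ℕ) < p then Finset.univ.filter (fun ω => ω ⟨(i : ℕ), h⟩ = true)
  else Finset.univ.filter (fun ω => f ω = true)

/-- The vector `c_i ∈ ℝ^({0,1}^p)`: `c_i(ω) = q_i - 1` if `ω ∈ Ω_i`, else `q_i`. -/
def cvec (p : ℕ) (f : Judg p → Bool) (q : Fin (p + 1) → ℝ) (i : Fin (p + 1)) :
    Judg p → ℝ :=
  fun ω => if ω ∈ Omega p f i then q i - 1 else q i

/-- Euclidean inner product on `ℝ^({0,1}^p)`. -/
def inn (p : ℕ) (u v : Judg p → ℝ) : ℝ := ∑ ω : Judg p, u ω * v ω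

/-- The histogram of a profile: how many agents cast each judgement. -/
def Hist (p n : ℕ) (P : Fin n → Judg p) (ω : Judg p) : ℕ :=
  (Finset.univ.filter (fun j => P j = ω)).card

/-- The histogram, viewed as a vector in `ℝ^({0,1}^p)`. -/
def HistR (p n : ℕ) (P : Fin n → Judg p) : Judg p → ℝ :=
  fun ω => (Hist p n P ω : ℝ)

/-- `n_i(P)`: the number of agents of `P` whose judgement lies in `Ω_i`. -/
def nOnes (p n : ℕ) (f : Judg p → Bool) (P : Fin n → Judg p) (i : Fin (p + 1)) : ℕ :=
  ∑ ω ∈ Omega p f i, Hist p n P ω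

/-- The quota rule on profiles, with thresholds `q` and tie-breakings `d`. -/
def quota (p n : ℕ) (f : Judg p → Bool) (q : Fin (p + 1) → ℝ) (d : Fin (p + 1) → Bool)
    (P : Fin n → Judg p) (i : Fin (p + 1)) : Bool := by
  classical
  exact if (nOnes p n f P i : ℝ) > q i * (n : ℝ) then true
    else if (nOnes p n f P i : ℝ) = q i * (n : ℝ) then d i
    else false

/-- The real value of a bit: `1` for `1`/true, `0` for `0`/false. -/
def bval (b : Bool) : ℝ := if b then 1 else 0

/-- `sign(1) = 1` and `sign(0) = -1`. -/
def sgn (b : Bool) : ℝ := if b then 1 else -1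

/-- `α ∈ {0,1}^{p+1}` is consistent if its conclusion component equals `f` applied to
its premise components. -/
def Consistent (p : ℕ) (f : Judg p → Bool) (α : Fin (p + 1) → Bool) : Prop :=
  α (Fin.last p) = f (fun j => α j.castSucc)

/-- A profile is a doctrinal paradox if the quota-rule output is inconsistent. -/
def Paradox (p n : ℕ) (f : Judg p → Bool) (q : Fin (p + 1) → ℝ) (d : Fin (p + 1) → Bool)
    (P : Fin n → Judg p) : Prop :=
  ¬ Consistent p f (quota p n f q d P)

/-- The polyhedron `H_α`. -/
def polyH (p : ℕ) (f : Judg p → Bool) (q : Fin (p + 1) → ℝ) (d : Fin (p + 1) → Bool)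
    (α : Fin (p + 1) → Bool) : Set (Judg p → ℝ) :=
  {x | ∀ i : Fin (p + 1),
    sgn (α i) * inn p (cvec p f q i) x ≤ sgn (α i) * bval (d i) - bval (α i)}

/-- The characteristic cone `H_{α,≤0}`. -/
def coneH (p : ℕ) (f : Judg p → Bool) (q : Fin (p + 1) → ℝ)
    (α : Fin (p + 1) → Bool) : Set (Judg p → ℝ) :=
  {x | ∀ i : Fin (p + 1), sgn (α i) * inn p (cvec p f q i) x ≤ 0}

/-- A probability distribution on `{0,1}^p`. -/
def IsDistribution (p : ℕ) (π : Judg p → ℝ) : Prop :=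
  (∀ ω, 0 ≤ π ω) ∧ ∑ ω : Judg p, π ω = 1

/-- `pr_i(π) = Σ_{ω ∈ Ω_i} π(ω)`. -/
def pr (p : ℕ) (f : Judg p → Bool) (π : Judg p → ℝ) (i : Fin (p + 1)) : ℝ :=
  ∑ ω ∈ Omega p f i, π ω

/-- The quota rule applied to a distribution. -/
def quotaDist (p : ℕ) (f : Judg p → Bool) (q : Fin (p + 1) → ℝ) (d : Fin (p + 1) → Bool)
    (π : Judg p → ℝ) (i : Fin (p + 1)) : Bool := by
  classical
  exact if pr p f π i > q i then true
    else if pr p f π i = q i then d i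
    else false

/-- `α` is a refinement of `π`: it matches `r(π)` on every non-tied proposition. -/
def Refines (p : ℕ) (f : Judg p → Bool) (q : Fin (p + 1) → ℝ) (d : Fin (p + 1) → Bool)
    (π : Judg p → ℝ) (α : Fin (p + 1) → Bool) : Prop :=
  ∀ i : Fin (p + 1), pr p f π i ≠ q i → α i = quotaDist p f q d π i

/-- `α` is an effective refinement of `π` at `n`: a refinement realized by some profile. -/
def EffRef (p n : ℕ) (f : Judg p → Bool) (q : Fin (p + 1) → ℝ) (d : Fin (p + 1) → Bool)
    (π : Judg p → ℝ) (α : Fin (p + 1) → Bool) : Prop :=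
  Refines p f q d π α ∧ ∃ P : Fin n → Judg p, quota p n f q d P = α

/-- The probability that a random profile drawn from the independent (non-identical)
product of `vπ` is a doctrinal paradox. -/
def probParadox (p n : ℕ) (f : Judg p → Bool) (q : Fin (p + 1) → ℝ)
    (d : Fin (p + 1) → Bool) (vπ : Fin n → Judg p → ℝ) : ℝ := by
  classical
  exact ∑ P : Fin n → Judg p,
    if Paradox p n f q d P then ∏ j : Fin n, vπ j (P j) else 0

/-- The max-smoothed likelihood of the doctrinal paradox. -/
def DPmax (p n : ℕ) (f : Judg p → Bool) (q : Fin (p + 1) → ℝ) (d : Fin (p + 1) → Bool)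
    (D : Set (Judg p → ℝ)) : ℝ :=
  sSup {x : ℝ | ∃ vπ : Fin n → Judg p → ℝ,
    (∀ j, vπ j ∈ D) ∧ x = probParadox p n f q d vπ}

/-- The min-smoothed likelihood of the doctrinal paradox. -/
def DPmin (p n : ℕ) (f : Judg p → Bool) (q : Fin (p + 1) → ℝ) (d : Fin (p + 1) → Bool)
    (D : Set (Judg p → ℝ)) : ℝ :=
  sInf {x : ℝ | ∃ vπ : Fin n → Judg p → ℝ,
    (∀ j, vπ j ∈ D) ∧ x = probParadox p n f q d vπ}

/-- Condition `κ1(n)`: no profile of `n` agents is a doctrinal paradox. -/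
def kappa1 (p n : ℕ) (f : Judg p → Bool) (q : Fin (p + 1) → ℝ)
    (d : Fin (p + 1) → Bool) : Prop :=
  ∀ P : Fin n → Judg p, ¬ Paradox p n f q d P

/-- Condition `κ2(n)`: every effective refinement at `n` of every `π` in the convex hull
of `D` is consistent. -/
def kappa2 (p n : ℕ) (f : Judg p → Bool) (q : Fin (p + 1) → ℝ) (d : Fin (p + 1) → Bool)
    (D : Set (Judg p → ℝ)) : Prop :=
  ∀ π ∈ convexHull ℝ D, ∀ α : Fin (p + 1) → Bool,
    EffRef p n f q d π α → Consistent p f α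

/-- Condition `κ3(n)`: some `π` in the convex hull of `D` has all its effective
refinements at `n` consistent. -/
def kappa3 (p n : ℕ) (f : Judg p → Bool) (q : Fin (p + 1) → ℝ) (d : Fin (p + 1) → Bool)
    (D : Set (Judg p → ℝ)) : Prop :=
  ∃ π ∈ convexHull ℝ D, ∀ α : Fin (p + 1) → Bool,
    EffRef p n f q d π α → Consistent p f α

/-- Condition `κ4`: the conclusion depends on exactly one premise, with matching
thresholds. -/
def kappa4 (p : ℕ) (f : Judg p → Bool) (q : Fin (p + 1) → ℝ) : Prop :=
  ∃ i : Fin p,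
    ((∀ ω : Judg p, f ω = ω i) ∧ q (Fin.last p) = q i.castSucc) ∨
    ((∀ ω : Judg p, f ω = !(ω i)) ∧ q (Fin.last p) = 1 - q i.castSucc)

/-- `D` is strictly positive: some `ε > 0` lower-bounds every probability. -/
def StrictlyPositive (p : ℕ) (D : Set (Judg p → ℝ)) : Prop :=
  ∃ ε > (0 : ℝ), ∀ π ∈ D, ∀ ω : Judg p, ε ≤ π ω

/-- The total mass that independent weights `w` give to the configurations in `A`. -/
def prodMass {ι Ω : Type*} [Fintype ι] (w : ι → Ω → ℝ) (A : Finset (ι → Ω)) : ℝ :=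
  ∑ P ∈ A, ∏ j, w j (P j)

section ProductWeights

variable {ι Ω : Type*} [Fintype ι] [DecidableEq ι] [Fintype Ω]

theorem prodMass_univ [DecidableEq Ω] (w : ι → Ω → ℝ) (hw : ∀ j, ∑ ω, w j ω = 1) :
    prodMass w Finset.univ = 1 := by
  simp [prodMass, ← Fintype.prod_sum, hw]

/-- The second moment of a sum of independent centred functions is the sum of their second
moments. -/
theorem sum_prod_mul_sq_sum (w h : ι → Ω → ℝ) (hw : ∀ j, ∑ ω, w j ω = 1)
    (hc : ∀ j, ∑ ω, w j ω * h j ω = 0) :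
    ∑ P : ι → Ω, (∏ j, w j (P j)) * (∑ j, h j (P j)) ^ 2 = ∑ j, ∑ ω, w j ω * h j ω ^ 2 := by
  have key : ∀ j k, ∑ P : ι → Ω, (∏ l, w l (P l)) * (h j (P j) * h k (P k)) =
      if j = k then ∑ ω, w j ω * h j ω ^ 2 else 0 := by
    intro j k
    have e : ∀ P : ι → Ω, (∏ l, w l (P l)) * (h j (P j) * h k (P k)) =
        ∏ l, (w l (P l) * ((if l = j then h l (P l) else 1) *
          (if l = k then h l (P l) else 1))) := by
      intro P
      rw [Finset.prod_mul_distrib, Finset.prod_mul_distrib, Fintype.prod_ite_eq',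
        Fintype.prod_ite_eq']
    simp only [e]
    rw [← Fintype.prod_sum
      (fun l ω => w l ω * ((if l = j then h l ω else 1) * (if l = k then h l ω else 1)))]
    split_ifs with hjk
    · subst hjk
      rw [Finset.prod_eq_single j]
      · simp [sq]
      · intro l _ hl
        simp [hl, hw]
      · simp
    · apply Finset.prod_eq_zero (Finset.mem_univ j)
      simp [hjk, hc]
  have e : ∀ P : ι → Ω, (∏ j, w j (P j)) * (∑ j, h j (P j)) ^ 2 =
      ∑ j, ∑ k, (∏ l, w l (P l)) * (h j (P j) * h k (P k)) := by
    intro P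
    rw [sq, Finset.sum_mul_sum, Finset.mul_sum]
    simp only [Finset.mul_sum]
  simp only [e]
  rw [Finset.sum_comm]
  refine Finset.sum_congr rfl fun j _ => ?_
  rw [Finset.sum_comm]
  simp [key]

/-- Chebyshev's inequality for finitely many sums of independent centred functions bounded
by one. -/
theorem prodMass_exists_sq_ge_le {κ : Type*} [Fintype κ] (w : ι → Ω → ℝ)
    (h : κ → ι → Ω → ℝ) (hnn : ∀ j ω, 0 ≤ w j ω) (hw : ∀ j, ∑ ω, w j ω = 1)
    (hc : ∀ i j, ∑ ω, w j ω * h i j ω = 0) (hb : ∀ i j ω, h i j ω ^ 2 ≤ 1)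
    (A : Finset (ι → Ω)) (s : ℝ) (hA : ∀ P ∈ A, ∃ i, s ≤ (∑ j, h i j (P j)) ^ 2) :
    s * prodMass w A ≤ Fintype.card κ * Fintype.card ι := by
  calc s * prodMass w A
      ≤ ∑ P ∈ A, (∏ j, w j (P j)) * ∑ i, (∑ j, h i j (P j)) ^ 2 := by
        rw [prodMass, Finset.mul_sum]
        refine Finset.sum_le_sum fun P hP => ?_
        rw [mul_comm]
        refine mul_le_mul_of_nonneg_left ?_ (Finset.prod_nonneg fun j _ => hnn j _)
        obtain ⟨i, hi⟩ := hA P hP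
        exact hi.trans (Finset.single_le_sum (f := fun i => (∑ j, h i j (P j)) ^ 2)
          (fun i _ => sq_nonneg _) (Finset.mem_univ i))
    _ ≤ ∑ P : ι → Ω, (∏ j, w j (P j)) * ∑ i, (∑ j, h i j (P j)) ^ 2 :=
        Finset.sum_le_sum_of_subset_of_nonneg (Finset.subset_univ _) fun P _ _ =>
          mul_nonneg (Finset.prod_nonneg fun j _ => hnn j _)
            (Finset.sum_nonneg fun i _ => sq_nonneg _)
    _ = ∑ i, ∑ j, ∑ ω, w j ω * h i j ω ^ 2 := by
        simp only [Finset.mul_sum]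
        rw [Finset.sum_comm]
        exact Finset.sum_congr rfl fun i _ => sum_prod_mul_sq_sum w (h i) hw (hc i)
    _ ≤ ∑ _i : κ, ∑ _j : ι, 1 := by
        refine Finset.sum_le_sum fun i _ => Finset.sum_le_sum fun j _ => ?_
        rw [← hw j]
        exact Finset.sum_le_sum fun ω _ => mul_le_of_le_one_right (hnn j ω) (hb i j ω)
    _ = _ := by simp

/-- Change of measure: perturbing every weight by `t * v` changes the mass of an event in a way
controlled by the chi-square divergence. -/
theorem sq_prodMass_tilt_le (w : ι → Ω → ℝ) (v : Ω → ℝ) {ε B t : ℝ} (hε : 0 < ε)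
    (hw : ∀ j, ∑ ω, w j ω = 1) (hwε : ∀ j ω, ε ≤ w j ω) (hv : ∑ ω, v ω = 0)
    (hB : ∀ ω, v ω ^ 2 ≤ B) (A : Finset (ι → Ω)) :
    prodMass (fun j ω => w j ω + t * v ω) A ^ 2 ≤
      prodMass w A * Real.exp (t ^ 2 * (Fintype.card Ω * (B / ε))) ^ Fintype.card ι := by
  have hpos : ∀ j ω, 0 < w j ω := fun j ω => hε.trans_le (hwε j ω)
  have hP : ∀ P : ι → Ω, 0 < ∏ j, w j (P j) := fun P => Finset.prod_pos fun j _ => hpos j _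
  have hone : ∀ j, ∑ ω, (w j ω + t * v ω) ^ 2 / w j ω ≤
      Real.exp (t ^ 2 * (Fintype.card Ω * (B / ε))) := by
    intro j
    have e : ∀ ω, (w j ω + t * v ω) ^ 2 / w j ω =
        w j ω + 2 * t * v ω + t ^ 2 * (v ω ^ 2 / w j ω) := by
      intro ω
      have := (hpos j ω).ne'
      field_simp
      ring
    simp only [e, Finset.sum_add_distrib, ← Finset.mul_sum, hw, hv]
    have : ∑ ω, v ω ^ 2 / w j ω ≤ ∑ _ω : Ω, B / ε :=
      Finset.sum_le_sum fun ω _ =>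
        div_le_div₀ ((sq_nonneg _).trans (hB ω)) (hB ω) hε (hwε j ω)
    rw [Finset.sum_const, nsmul_eq_mul, Finset.card_univ] at this
    have := mul_le_mul_of_nonneg_left this (sq_nonneg t)
    have := Real.add_one_le_exp (t ^ 2 * (Fintype.card Ω * (B / ε)))
    linarith
  calc prodMass (fun j ω => w j ω + t * v ω) A ^ 2
      ≤ prodMass w A * ∑ P ∈ A, ∏ j, ((w j (P j) + t * v (P j)) ^ 2 / w j (P j)) := by
        refine Finset.sum_sq_le_sum_mul_sum_of_sq_le_mul A (fun P _ => (hP P).le)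
          (fun P _ => Finset.prod_nonneg fun j _ => div_nonneg (sq_nonneg _) (hpos j _).le)
          fun P _ => le_of_eq ?_
        rw [Finset.prod_div_distrib, Finset.prod_pow]
        have := (hP P).ne'
        field_simp
    _ ≤ prodMass w A * ∑ P : ι → Ω, ∏ j, ((w j (P j) + t * v (P j)) ^ 2 / w j (P j)) := by
        refine mul_le_mul_of_nonneg_left ?_ (Finset.sum_nonneg fun P _ => (hP P).le)
        exact Finset.sum_le_sum_of_subset_of_nonneg (Finset.subset_univ _) fun P _ _ =>
          Finset.prod_nonneg fun j _ => div_nonneg (sq_nonneg _) (hpos j _).le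
    _ = prodMass w A * ∏ j, ∑ ω, (w j ω + t * v ω) ^ 2 / w j ω := by
        rw [Fintype.prod_sum]
    _ ≤ _ := by
        refine mul_le_mul_of_nonneg_left ?_ (Finset.sum_nonneg fun P _ => (hP P).le)
        refine (Finset.prod_le_prod (fun j _ => Finset.sum_nonneg fun ω _ =>
          div_nonneg (sq_nonneg _) (hpos j _).le) fun j _ => hone j).trans_eq ?_
        simp

/-- The number of independent trials with common success probability `q` that succeed is
binomially distributed. -/
theorem prodMass_card_filter_eq (S : Finset Ω) [DecidableEq Ω] (w : ι → Ω → ℝ) {q : ℝ}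
    (hq : 0 < q) (hw : ∀ j, ∑ ω, w j ω = 1) (hS : ∀ j, ∑ ω ∈ S, w j ω = q) (m : ℕ)
    (hm : m ≤ Fintype.card ι) :
    prodMass w {P | (Finset.univ.filter fun j => P j ∈ S).card = m} =
      (Fintype.card ι).choose m * q ^ m * (1 - q) ^ (Fintype.card ι - m) := by
  classical
  open Polynomial in
  have gen : ∑ P : ι → Ω, ∏ j, (C (w j (P j)) * X ^ (if P j ∈ S then 1 else 0) : ℝ[X]) =
      C (q ^ Fintype.card ι) * (X + C ((1 - q) / q)) ^ Fintype.card ι := by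
    rw [← Fintype.prod_sum (fun j ω => (C (w j ω) * X ^ (if ω ∈ S then 1 else 0) : ℝ[X]))]
    have : ∀ j, ∑ ω, (C (w j ω) * X ^ (if ω ∈ S then 1 else 0) : ℝ[X]) =
        C q * (X + C ((1 - q) / q)) := by
      intro j
      have hSc : ∑ ω ∈ Sᶜ, w j ω = 1 - q := by
        rw [← hw j, ← hS j, ← Finset.sum_add_sum_compl S]
        ring
      rw [← Finset.sum_add_sum_compl S,
        Finset.sum_congr rfl (g := fun ω => C (w j ω) * X) (fun ω hω => by simp [hω]),
        Finset.sum_congr rfl (s₁ := Sᶜ) (g := fun ω => C (w j ω))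
          (fun ω hω => by simp [Finset.mem_compl.1 hω]),
        ← Finset.sum_mul, ← map_sum, ← map_sum, hS, hSc, mul_add, ← C_mul,
        mul_div_cancel₀ _ hq.ne']
    rw [Finset.prod_congr rfl fun j _ => this j, Finset.prod_const, Finset.card_univ, mul_pow,
      C_pow]
  have := congrArg (fun f => Polynomial.coeff f m) gen
  simp only [Finset.prod_mul_distrib, Finset.prod_pow_eq_pow_sum, ← map_prod,
    Polynomial.finsetSum_coeff, Polynomial.coeff_C_mul, Polynomial.coeff_X_add_C_pow,
    Polynomial.coeff_X_pow] at this
  rw [prodMass, Finset.sum_filter]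
  simp only [mul_ite, mul_one, mul_zero, Finset.sum_boole, Nat.cast_id] at this
  simp only [eq_comm (a := m)] at this
  rw [this, div_pow]
  obtain ⟨k, hk⟩ := Nat.exists_eq_add_of_le hm
  rw [hk, Nat.add_sub_cancel_left, pow_add]
  field_simp

end ProductWeights

theorem factorial_le_exp_mul_sqrt {n : ℕ} (hn : n ≠ 0) :
    (n.factorial : ℝ) ≤ Real.exp 1 * √n * (n / Real.exp 1) ^ n := by
  obtain ⟨k, rfl⟩ := Nat.exists_eq_succ_of_ne_zero hn
  have h := Stirling.stirlingSeq'_antitone (Nat.zero_le k)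
  simp only [Function.comp, Nat.succ_eq_add_one, zero_add, Stirling.stirlingSeq_one] at h
  rw [Stirling.stirlingSeq, div_le_iff₀ (by positivity), Real.sqrt_mul (by positivity)] at h
  refine h.trans_eq ?_
  have : √2 ≠ 0 := by positivity
  field_simp

/-- A binomial variable with integer mean takes the value of its mean with probability at least
of order `n ^ (-1/2)`. -/
theorem inv_sqrt_le_binomial_mean {q : ℝ} (hq : 0 < q) (hq1 : q < 1) {n m : ℕ} (hn : n ≠ 0)
    (hm : (m : ℝ) = q * n) :
    Real.exp (-2) * (√n)⁻¹ ≤ n.choose m * q ^ m * (1 - q) ^ (n - m) := by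
  have hn' : (0 : ℝ) < n := by positivity
  have hm0 : (0 : ℝ) < m := by rw [hm]; positivity
  have hmn : (m : ℝ) < n := by rw [hm]; nlinarith
  have hmn' : m < n := by exact_mod_cast hmn
  obtain ⟨l, rfl⟩ := Nat.exists_eq_add_of_le hmn'.le
  have hl : l ≠ 0 := by omega
  have hl0 : (0 : ℝ) < l := by positivity
  have e1 : q = m / (m + l : ℕ) := by rw [hm]; field_simp
  have e2 : 1 - q = l / (m + l : ℕ) := by
    rw [e1, eq_div_iff hn'.ne', sub_mul, div_mul_cancel₀ _ hn'.ne']; push_cast; ring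
  have hmf := factorial_le_exp_mul_sqrt (n := m) (by rintro rfl; simp at hm0)
  have hlf := factorial_le_exp_mul_sqrt hl
  have hnf := Stirling.le_factorial_stirling (m + l)
  have hc : ((m + l).choose m : ℝ) * (m.factorial * l.factorial) = (m + l).factorial := by
    have := Nat.choose_mul_factorial_mul_factorial (Nat.le_add_right m l)
    rw [Nat.add_sub_cancel_left] at this
    rw [← mul_assoc]
    exact_mod_cast this
  have hden : (0 : ℝ) < m.factorial * l.factorial := by positivity
  rw [← eq_div_iff hden.ne'] at hc
  rw [Nat.add_sub_cancel_left, e2, e1, hc]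
  have hfac : (m.factorial : ℝ) * l.factorial ≤
      Real.exp 2 * (m + l : ℕ) * ((m / Real.exp 1) ^ m * (l / Real.exp 1) ^ l) := by
    have hs : √(m : ℝ) * √(l : ℝ) ≤ (m + l : ℕ) := by
      have h1 := Real.sq_sqrt hm0.le
      have h2 := Real.sq_sqrt hl0.le
      push_cast
      nlinarith [sq_nonneg (√(m : ℝ) - √(l : ℝ))]
    have he : Real.exp 2 = Real.exp 1 * Real.exp 1 := by rw [← Real.exp_add]; norm_num
    calc (m.factorial : ℝ) * l.factorial
        ≤ (Real.exp 1 * √m * (m / Real.exp 1) ^ m) * (Real.exp 1 * √l * (l / Real.exp 1) ^ l) := by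
          gcongr
      _ = Real.exp 2 * (√m * √l) * ((m / Real.exp 1) ^ m * (l / Real.exp 1) ^ l) := by
          rw [he]; ring
      _ ≤ _ := by gcongr
  have hnf' : √((m + l : ℕ) : ℝ) * ((m + l : ℕ) / Real.exp 1) ^ (m + l) ≤
      ((m + l).factorial : ℝ) := by
    refine le_trans ?_ hnf
    gcongr
    nlinarith [Real.pi_gt_three]
  calc Real.exp (-2) * (√((m + l : ℕ) : ℝ))⁻¹
      = √((m + l : ℕ) : ℝ) * ((m + l : ℕ) / Real.exp 1) ^ (m + l) /
          (Real.exp 2 * (m + l : ℕ) * ((m / Real.exp 1) ^ m * (l / Real.exp 1) ^ l)) *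
          (m / (m + l : ℕ)) ^ m * (l / (m + l : ℕ)) ^ l := by
        have hs : √((m + l : ℕ) : ℝ) ^ 2 = (m + l : ℕ) := Real.sq_sqrt hn'.le
        have hs0 : √((m + l : ℕ) : ℝ) ≠ 0 := by positivity
        rw [Real.exp_neg, div_pow, div_pow, div_pow, div_pow, div_pow, pow_add, pow_add]
        generalize ((m + l : ℕ) : ℝ) = N at *
        field_simp
        rw [hs]
    _ ≤ _ := by gcongr

theorem sgn_mul_self (b : Bool) : sgn b * sgn b = 1 := by cases b <;> simp [sgn]

theorem abs_sgn (b : Bool) : |sgn b| = 1 := by cases b <;> simp [sgn]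

theorem sgn_not (b : Bool) : sgn (!b) = -sgn b := by cases b <;> simp [sgn]

section Quota

variable {p n : ℕ} {f : Judg p → Bool} {q : Fin (p + 1) → ℝ} {d : Fin (p + 1) → Bool}

theorem pr_eq_sum_ite (u : Judg p → ℝ) (i : Fin (p + 1)) :
    pr p f u i = ∑ ω, u ω * (if ω ∈ Omega p f i then 1 else 0) := by
  simp [pr]

theorem pr_castSucc (u : Judg p → ℝ) (k : Fin p) :
    pr p f u k.castSucc = ∑ ω, u ω * bval (ω k) := by
  simp [pr, Omega, bval, Finset.sum_filter]

theorem pr_last (u : Judg p → ℝ) :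
    pr p f u (Fin.last p) = ∑ ω, u ω * bval (f ω) := by
  simp [pr, Omega, bval, Finset.sum_filter]

theorem pr_add_mul (u v : Judg p → ℝ) (t : ℝ) (i : Fin (p + 1)) :
    pr p f (fun ω => u ω + t * v ω) i = pr p f u i + t * pr p f v i := by
  simp [pr, Finset.sum_add_distrib, Finset.mul_sum]

theorem pr_average (w : Fin n → Judg p → ℝ) (i : Fin (p + 1)) :
    pr p f (fun ω => ∑ j, (n : ℝ)⁻¹ * w j ω) i = (n : ℝ)⁻¹ * ∑ j, pr p f (w j) i := by
  simp only [pr]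
  rw [Finset.sum_comm]
  simp [Finset.mul_sum]

theorem nOnes_eq_card (P : Fin n → Judg p) (i : Fin (p + 1)) :
    nOnes p n f P i = (Finset.univ.filter fun j => P j ∈ Omega p f i).card := by
  rw [nOnes, Finset.card_eq_sum_card_fiberwise (f := P) (t := Omega p f i)
    (fun j hj => by simpa using hj)]
  refine Finset.sum_congr rfl fun ω hω => ?_
  rw [Hist, Finset.filter_filter]
  congr 1
  ext j
  simp only [Finset.mem_filter, Finset.mem_univ, true_and]
  constructor
  · rintro rfl
    exact ⟨hω, rfl⟩
  · exact fun h => h.2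

theorem nOnes_eq_pr (P : Fin n → Judg p) (i : Fin (p + 1)) :
    (nOnes p n f P i : ℝ) = pr p f (HistR p n P) i := by
  simp [nOnes, pr, HistR]

theorem sum_HistR (P : Fin n → Judg p) : ∑ ω, HistR p n P ω = n := by
  have := Finset.card_eq_sum_card_fiberwise (f := P) (s := Finset.univ) (t := Finset.univ)
    (fun j _ => by simp)
  simp only [HistR, Hist]
  rw [← Nat.cast_sum, ← this]
  simp

theorem quota_eq_of_pos {P : Fin n → Judg p} {i : Fin (p + 1)} {b : Bool}
    (h : 0 < sgn b * ((nOnes p n f P i : ℝ) - q i * n)) : quota p n f q d P i = b := by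
  cases b <;> simp only [sgn, quota] at *
  · rw [if_neg, if_neg]
    all_goals simp at h; linarith
  · rw [if_pos]
    simp at h; linarith

theorem sgn_quota_mul_nonneg (P : Fin n → Judg p) (i : Fin (p + 1)) :
    0 ≤ sgn (quota p n f q d P i) * ((nOnes p n f P i : ℝ) - q i * n) := by
  simp only [quota]
  split_ifs with h1 h2
  · simp [sgn]; linarith
  · simp [h2]
  · simp [sgn]; linarith

theorem Refines.sgn_mul_nonneg {π : Judg p → ℝ} {α : Fin (p + 1) → Bool}
    (h : Refines p f q d π α) (i : Fin (p + 1)) :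
    0 ≤ sgn (α i) * (pr p f π i - q i) := by
  by_cases hi : pr p f π i = q i
  · simp [hi]
  · rw [h i hi]
    simp only [quotaDist, if_neg hi]
    split_ifs with h1
    · simp [sgn]; linarith
    · simp [sgn]; linarith

open Classical in
theorem probParadox_eq_prodMass (w : Fin n → Judg p → ℝ) :
    probParadox p n f q d w = prodMass w {P | Paradox p n f q d P} := by
  rw [probParadox, prodMass, Finset.sum_filter]

theorem prodMass_le_probParadox {w : Fin n → Judg p → ℝ} (hw : ∀ j ω, 0 ≤ w j ω)
    {A : Finset (Fin n → Judg p)} (hA : ∀ P ∈ A, Paradox p n f q d P) :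
    prodMass w A ≤ probParadox p n f q d w := by
  classical
  rw [probParadox_eq_prodMass]
  exact Finset.sum_le_sum_of_subset_of_nonneg (fun P hP => by simpa using hA P hP)
    fun P _ _ => Finset.prod_nonneg fun j _ => hw j _

/-- An independent profile produces the quota outcome `α` with probability bounded below, as soon
as the average distribution weakly agrees with `α` and a sum-zero direction `v` moves every
proposition that is close to its threshold towards `α`. -/
theorem exists_le_prodMass_quota_eq (p : ℕ) (f : Judg p → Bool) (q : Fin (p + 1) → ℝ)
    (d : Fin (p + 1) → Bool) {ε η B : ℝ} (hε : 0 < ε) (hη : 0 < η) (hB : 0 ≤ B) :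
    ∃ c > (0 : ℝ), ∃ N : ℕ, ∀ n ≥ N, ∀ w : Fin n → Judg p → ℝ,
      (∀ j, ∑ ω, w j ω = 1) → (∀ j ω, ε ≤ w j ω) → ∀ v : Judg p → ℝ, ∑ ω, v ω = 0 →
      (∀ ω, |v ω| ≤ B) → ∀ α : Fin (p + 1) → Bool,
      (∀ i, 0 ≤ sgn (α i) * (pr p f (fun ω => ∑ j, (n : ℝ)⁻¹ * w j ω) i - q i)) →
      (∀ i, 1 ≤ sgn (α i) * pr p f v i ∨
        η ≤ |pr p f (fun ω => ∑ j, (n : ℝ)⁻¹ * w j ω) i - q i|) →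
      c ≤ prodMass w {P | quota p n f q d P = α} := by
  set T : ℝ := p + 2 with hT
  have hT0 : 0 < T := by positivity
  set M : ℝ := ((Fintype.card (Judg p) : ℕ) : ℝ) with hM
  set R : ℝ := T * B / ε + T * (M * B + 1) / η + 1 with hR
  have hR1 : 0 ≤ T * B / ε := by positivity
  have hR2 : 0 ≤ T * (M * B + 1) / η := by positivity
  refine ⟨1 / 4 * Real.exp (-(T ^ 2 * (M * (B ^ 2 / ε)))), by positivity, ⌈R ^ 2⌉₊, ?_⟩
  intro n hn w hw hwε v hv hvB α hα hdir
  have hRn : R ≤ √n := Real.le_sqrt_of_sq_le ((Nat.le_ceil _).trans (by exact_mod_cast hn))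
  have hr0 : 0 < √(n : ℝ) := by linarith
  have hn0 : (0 : ℝ) < n := Real.sqrt_pos.1 hr0
  have hrr : √(n : ℝ) * √(n : ℝ) = n := Real.mul_self_sqrt hn0.le
  set t : ℝ := T / √n with ht
  have hnt : n * t = T * √n := by rw [ht]; field_simp; rw [sq, hrr]
  have hnt2 : n * t ^ 2 = T ^ 2 := by rw [ht, div_pow, Real.sq_sqrt hn0.le]; field_simp
  set w' : Fin n → Judg p → ℝ := fun j ω => w j ω + t * v ω with hw'
  have hw'nn : ∀ j ω, 0 ≤ w' j ω := by
    intro j ω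
    have h1 : t * B ≤ ε := by
      rw [ht, div_mul_eq_mul_div, div_le_iff₀ hr0, mul_comm ε, ← div_le_iff₀ hε]
      linarith
    have h2 : t * (-B) ≤ t * v ω :=
      mul_le_mul_of_nonneg_left (abs_le.1 (hvB ω)).1 (by positivity)
    have := hwε j ω
    simp only [hw']
    linarith
  have hw'1 : ∀ j, ∑ ω, w' j ω = 1 := by
    intro j
    simp [hw', Finset.sum_add_distrib, ← Finset.mul_sum, hw, hv]
  have hprv : ∀ i, |pr p f v i| ≤ M * B := by
    intro i
    calc |pr p f v i| ≤ ∑ ω ∈ Omega p f i, |v ω| := Finset.abs_sum_le_sum_abs _ _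
      _ ≤ ∑ ω, |v ω| := Finset.sum_le_sum_of_subset_of_nonneg (Finset.subset_univ _)
          fun _ _ _ => abs_nonneg _
      _ ≤ ∑ _ω : Judg p, B := Finset.sum_le_sum fun ω _ => hvB ω
      _ = M * B := by rw [Finset.sum_const, nsmul_eq_mul, Finset.card_univ]
  let h : Fin (p + 1) → Fin n → Judg p → ℝ := fun i j ω =>
    (if ω ∈ Omega p f i then 1 else 0) - pr p f (w' j) i
  have hc : ∀ i j, ∑ ω, w' j ω * h i j ω = 0 := by
    intro i j
    simp only [h, mul_sub, Finset.sum_sub_distrib, ← Finset.sum_mul, hw'1, ← pr_eq_sum_ite]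
    ring
  have hb : ∀ i j ω, h i j ω ^ 2 ≤ 1 := by
    intro i j ω
    have h0 : 0 ≤ pr p f (w' j) i := Finset.sum_nonneg fun ω _ => hw'nn j ω
    have h1 : pr p f (w' j) i ≤ 1 := by
      rw [← hw'1 j]
      exact Finset.sum_le_sum_of_subset_of_nonneg (Finset.subset_univ _) fun ω _ _ => hw'nn j ω
    simp only [h]
    split_ifs <;> nlinarith
  have hsum : ∀ (P : Fin n → Judg p) i, ∑ j, h i j (P j) =
      nOnes p n f P i -
        (n * pr p f (fun ω => ∑ j, (n : ℝ)⁻¹ * w j ω) i + T * √n * pr p f v i) := by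
    intro P i
    have e : ∀ j, pr p f (w' j) i = pr p f (w j) i + t * pr p f v i :=
      fun j => pr_add_mul _ _ _ _
    simp only [h, Finset.sum_sub_distrib, e, Finset.sum_add_distrib, pr_average, nOnes_eq_card]
    rw [mul_inv_cancel_left₀ hn0.ne', ← hnt]
    simp [mul_assoc]
  set A : Finset (Fin n → Judg p) :=
    {P | ∀ i, (∑ j, h i j (P j)) ^ 2 < T ^ 2 * n} with hA
  have hAc : T ^ 2 * n * prodMass w' Aᶜ ≤ (p + 1) * n := by
    have := prodMass_exists_sq_ge_le w' h hw'nn hw'1 hc hb Aᶜ (T ^ 2 * n) (by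
      intro P hP
      simpa [hA] using hP)
    simpa using this
  have hmass : 1 / 2 ≤ prodMass w' A := by
    have h1 : prodMass w' A + prodMass w' Aᶜ = 1 := by
      rw [← prodMass_univ w' hw'1, prodMass, prodMass, prodMass, Finset.sum_add_sum_compl]
    have h2 : T ^ 2 * prodMass w' Aᶜ ≤ p + 1 := by
      refine le_of_mul_le_mul_right ?_ hn0
      linarith
    have h3 : (p : ℝ) + 1 ≤ T ^ 2 * (1 / 2) := by rw [hT]; nlinarith
    have h4 := le_of_mul_le_mul_left (h2.trans h3) (by positivity)
    linarith
  have htilt := sq_prodMass_tilt_le (t := t) w v hε hw hwε hv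
    (fun ω => by simpa using pow_le_pow_left₀ (abs_nonneg _) (hvB ω) 2) A
  rw [← Real.exp_nat_mul, Fintype.card_fin, ← mul_assoc, hnt2, ← hM] at htilt
  have hle : 1 / 4 ≤ prodMass w A * Real.exp (T ^ 2 * (M * (B ^ 2 / ε))) := by
    refine le_trans ?_ htilt
    change 1 / 4 ≤ prodMass w' A ^ 2
    nlinarith
  have hwA : 1 / 4 * Real.exp (-(T ^ 2 * (M * (B ^ 2 / ε)))) ≤ prodMass w A := by
    rw [Real.exp_neg, ← div_eq_mul_inv, div_le_iff₀ (Real.exp_pos _)]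
    exact hle
  refine hwA.trans (Finset.sum_le_sum_of_subset_of_nonneg ?_ fun P _ _ =>
    Finset.prod_nonneg fun j _ => hε.le.trans (hwε j _))
  intro P hP
  simp only [hA, Finset.mem_filter, Finset.mem_univ, true_and] at hP ⊢
  funext i
  apply quota_eq_of_pos
  have hPi := hP i
  rw [hsum] at hPi
  set x := pr p f (fun ω => ∑ j, (n : ℝ)⁻¹ * w j ω) i with hx
  set b := pr p f v i with hbdef
  set e : ℝ := nOnes p n f P i - (n * x + T * √n * b) with he
  have habs : |sgn (α i) * e| < T * √n := by
    rw [abs_mul, abs_sgn, one_mul]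
    refine abs_lt_of_sq_lt_sq ?_ (by positivity)
    rwa [mul_pow, Real.sq_sqrt hn0.le]
  have hsplit : sgn (α i) * ((nOnes p n f P i : ℝ) - q i * n) =
      n * (sgn (α i) * (x - q i)) + T * √n * (sgn (α i) * b) + sgn (α i) * e := by
    rw [he]; ring
  rw [hsplit]
  have he' := (abs_lt.1 habs).1
  rcases hdir i with h1 | h1
  · have h2 : T * √n * 1 ≤ T * √n * (sgn (α i) * b) := by gcongr
    have h3 := mul_nonneg hn0.le (hα i)
    linarith
  · have h2 : η ≤ sgn (α i) * (x - q i) := by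
      rwa [← abs_of_nonneg (hα i), abs_mul, abs_sgn, one_mul]
    have h3 : -(M * B) ≤ sgn (α i) * b := by
      have : |sgn (α i) * b| ≤ M * B := by
        rw [abs_mul, abs_sgn, one_mul]
        exact hprv i
      exact (abs_le.1 this).1
    have h4 : T * √n * -(M * B) ≤ T * √n * (sgn (α i) * b) := by gcongr
    have h5 : n * η ≤ n * (sgn (α i) * (x - q i)) := by gcongr
    have h6 : T * (M * B + 1) < √n * η := by
      rw [← div_lt_iff₀ hη]
      linarith
    have h7 := mul_lt_mul_of_pos_left h6 hr0
    rw [← mul_assoc √(n : ℝ) √(n : ℝ), hrr] at h7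
    linarith

end Quota

theorem bval_injective : Function.Injective bval := by
  intro a b; cases a <;> cases b <;> simp [bval]

theorem bval_xor (b x : Bool) : bval (b ^^ x) = bval b - sgn b * bval x := by
  cases b <;> cases x <;> simp [bval, sgn]

section Connection

variable {p : ℕ}

/-- The judgement accepting exactly the premise `k`. -/
def unitJudg (k : Fin p) : Judg p := fun j => decide (j = k)

/-- The judgement rejecting every premise. -/
def zeroJudg : Judg p := fun _ => false

/-- The failure at `ω` of the affine interpolation of `f` through `zeroJudg` and the unit
judgements. -/
def affineDefect (f : Judg p → Bool) (ω : Judg p) : ℝ :=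
  bval (f ω) - bval (f zeroJudg) -
    ∑ k, bval (ω k) * (bval (f (unitJudg k)) - bval (f zeroJudg))

/-- A connection without affine defect is constant or depends on a single premise. -/
theorem const_or_xor_of_affineDefect_eq_zero {f : Judg p → Bool}
    (h : ∀ ω, affineDefect f ω = 0) :
    (∃ b, ∀ ω, f ω = b) ∨ ∃ k b, ∀ ω, f ω = (b ^^ ω k) := by
  by_cases hk : ∃ k, f (unitJudg k) ≠ f zeroJudg
  · right
    obtain ⟨k, hk⟩ := hk
    have hj : ∀ j ≠ k, f (unitJudg j) = f zeroJudg := by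
      intro j hjk
      by_contra hj
      have h2 := h fun l => decide (l = j) || decide (l = k)
      rw [affineDefect, Fintype.sum_eq_add j k hjk (fun l hl => by simp [hl.1, hl.2, bval])] at h2
      revert h2 hj hk
      generalize f (unitJudg j) = a
      generalize f (unitJudg k) = b
      generalize f zeroJudg = c
      generalize f _ = e
      cases a <;> cases b <;> cases c <;> cases e <;> norm_num [bval]
    refine ⟨k, f zeroJudg, fun ω => ?_⟩
    have h2 := h ω
    rw [affineDefect, Fintype.sum_eq_single k (fun l hl => by simp [hj l hl])] at h2
    revert h2 hk
    generalize f (unitJudg k) = b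
    generalize f zeroJudg = c
    generalize f ω = e
    generalize ω k = a
    cases a <;> cases b <;> cases c <;> cases e <;> norm_num [bval]
  · left
    push Not at hk
    refine ⟨f zeroJudg, fun ω => bval_injective ?_⟩
    have := h ω
    simp only [affineDefect, hk, sub_self, mul_zero, Finset.sum_const_zero] at this
    linarith

/-- The direction moving mass `a k` from `zeroJudg` to the `k`-th unit judgement. -/
def premiseDir (a : Fin p → ℝ) (ω : Judg p) : ℝ :=
  ∑ k, a k * ((if ω = unitJudg k then 1 else 0) - if ω = zeroJudg then 1 else 0)

theorem sum_premiseDir_mul (a : Fin p → ℝ) (g : Judg p → ℝ) :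
    ∑ ω, premiseDir a ω * g ω = ∑ k, a k * (g (unitJudg k) - g zeroJudg) := by
  simp only [premiseDir, Finset.sum_mul]
  rw [Finset.sum_comm]
  refine Finset.sum_congr rfl fun k _ => ?_
  simp [mul_assoc, sub_mul, ← Finset.mul_sum, Finset.sum_sub_distrib]

theorem sum_premiseDir (a : Fin p → ℝ) : ∑ ω, premiseDir a ω = 0 := by
  simpa using sum_premiseDir_mul a 1

theorem sum_premiseDir_mul_bval (a : Fin p → ℝ) (k : Fin p) :
    ∑ ω, premiseDir a ω * bval (ω k) = a k := by
  rw [sum_premiseDir_mul a fun ω => bval (ω k)]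
  simp [unitJudg, zeroJudg, bval]

/-- If `f` has an affine defect, sum-zero directions can move all propositions independently. -/
theorem exists_direction_of_affineDefect_ne_zero {f : Judg p → Bool} {ω₀ : Judg p}
    (h : affineDefect f ω₀ ≠ 0) (b : Fin (p + 1) → ℝ) :
    ∃ v : Judg p → ℝ, ∑ ω, v ω = 0 ∧ ∀ i, pr p f v i = b i := by
  let u : Judg p → ℝ := fun ω => (if ω = ω₀ then 1 else 0) - (if ω = zeroJudg then 1 else 0) +
    -1 * premiseDir (fun k => bval (ω₀ k)) ω
  have hu : ∀ g : Judg p → ℝ, ∑ ω, u ω * g ω = g ω₀ - g zeroJudg -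
      ∑ k, bval (ω₀ k) * (g (unitJudg k) - g zeroJudg) := by
    intro g
    rw [← sum_premiseDir_mul]
    simp [u, add_mul, Finset.sum_add_distrib, sub_eq_add_neg]
  have hu0 : ∑ ω, u ω = 0 := by simpa using hu 1
  have huk : ∀ k : Fin p, pr p f u k.castSucc = 0 := by
    intro k
    rw [pr_castSucc, hu fun ω => bval (ω k)]
    simp [unitJudg, zeroJudg, bval]
  have hul : pr p f u (Fin.last p) = affineDefect f ω₀ := by
    rw [pr_last, hu fun ω => bval (f ω), affineDefect]
  set w := premiseDir fun k : Fin p => b k.castSucc with hw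
  refine ⟨fun ω => w ω +
    (b (Fin.last p) - pr p f w (Fin.last p)) / affineDefect f ω₀ * u ω, ?_, fun i => ?_⟩
  · rw [Finset.sum_add_distrib, ← Finset.mul_sum, hu0, hw, sum_premiseDir]
    simp
  · rw [pr_add_mul]
    refine Fin.lastCases ?_ (fun k => ?_) i
    · rw [hul]
      field_simp
      ring
    · rw [huk, pr_castSucc, hw, sum_premiseDir_mul_bval]
      simp

theorem pr_last_of_xor {f : Judg p → Bool} {k : Fin p} {b : Bool}
    (hf : ∀ ω, f ω = (b ^^ ω k)) (u : Judg p → ℝ) :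
    pr p f u (Fin.last p) = bval b * ∑ ω, u ω - sgn b * pr p f u k.castSucc := by
  rw [pr_last, pr_castSucc, Finset.mul_sum, Finset.mul_sum, ← Finset.sum_sub_distrib]
  refine Finset.sum_congr rfl fun ω _ => ?_
  rw [hf, bval_xor]
  ring

theorem sgn_last_of_not_consistent {f : Judg p → Bool} {k : Fin p} {b : Bool}
    (hf : ∀ ω, f ω = (b ^^ ω k)) {α : Fin (p + 1) → Bool} (hα : ¬ Consistent p f α) :
    sgn (α (Fin.last p)) = sgn b * sgn (α k.castSucc) := by
  rw [Consistent, hf] at hα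
  revert hα
  generalize α (Fin.last p) = x
  generalize α k.castSucc = y
  cases b <;> cases x <;> cases y <;> simp [sgn]

end Connection

section LowerBound

variable {p : ℕ} {f : Judg p → Bool} {q : Fin (p + 1) → ℝ} {d : Fin (p + 1) → Bool}
  {D : Set (Judg p → ℝ)}

/-- Paradoxes have probability at least of order `n ^ (-1/2)` for all large `n` at which neither
`kappa1` nor `kappa3` holds. -/
def EventualParadoxBound (p : ℕ) (f : Judg p → Bool) (q : Fin (p + 1) → ℝ)
    (d : Fin (p + 1) → Bool) (D : Set (Judg p → ℝ)) : Prop :=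
  ∃ c > (0 : ℝ), ∃ N : ℕ, ∀ n ≥ N, 1 ≤ n → ¬ kappa1 p n f q d → ¬ kappa3 p n f q d D →
    ∀ w : Fin n → Judg p → ℝ, (∀ j, w j ∈ D) →
      c * (n : ℝ) ^ (-(1 : ℝ) / 2) ≤ probParadox p n f q d w

theorem rpow_neg_half_le_one {n : ℕ} (hn : 1 ≤ n) : (n : ℝ) ^ (-(1 : ℝ) / 2) ≤ 1 :=
  Real.rpow_le_one_of_one_le_of_nonpos (by exact_mod_cast hn) (by norm_num)

theorem average_mem_convexHull {n : ℕ} (hn : 1 ≤ n) {w : Fin n → Judg p → ℝ}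
    (hw : ∀ j, w j ∈ D) : (fun ω => ∑ j, (n : ℝ)⁻¹ * w j ω) ∈ convexHull ℝ D := by
  have h0 : (n : ℝ) ≠ 0 := by positivity
  have := (convex_convexHull ℝ D).sum_mem (t := Finset.univ) (w := fun _ : Fin n => (n : ℝ)⁻¹)
    (z := w) (fun _ _ => by positivity) (by simp [h0])
    fun j _ => subset_convexHull ℝ D (hw j)
  convert this using 1
  ext ω
  simp

theorem sum_eq_one_of_mem_convexHull (hdist : ∀ π ∈ D, IsDistribution p π) {π : Judg p → ℝ}
    (hπ : π ∈ convexHull ℝ D) : ∑ ω, π ω = 1 := by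
  refine convexHull_min (t := {π : Judg p → ℝ | ∑ ω, π ω = 1}) (fun π hπ => (hdist π hπ).2) ?_ hπ
  intro x hx y hy a b _ _ hab
  simp only [Set.mem_ofPred_eq] at *
  simp [Finset.sum_add_distrib, ← Finset.mul_sum, hx, hy, hab]

/-- A bound on the probability of a paradox for all large `n` extends to all `n`. -/
theorem exists_le_DPmin_of_eventually (hne : D.Nonempty) (hsp : StrictlyPositive p D)
    (hdist : ∀ π ∈ D, IsDistribution p π)
    (h : EventualParadoxBound p f q d D) :
    ∃ c > (0 : ℝ), ∀ n : ℕ, 1 ≤ n → ¬ kappa1 p n f q d → ¬ kappa3 p n f q d D →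
      c * (n : ℝ) ^ (-(1 : ℝ) / 2) ≤ DPmin p n f q d D := by
  obtain ⟨c, hc, N, h⟩ := h
  obtain ⟨ε, hε, hεD⟩ := hsp
  have hε1 : ε ≤ 1 := by
    obtain ⟨π, hπ⟩ := hne
    exact (hεD π hπ zeroJudg).trans ((Finset.single_le_sum (fun ω _ => (hdist π hπ).1 ω)
      (Finset.mem_univ _)).trans_eq (hdist π hπ).2)
  refine ⟨min c (ε ^ N), lt_min hc (pow_pos hε N), fun n hn h1 h3 => ?_⟩
  obtain ⟨π₀, hπ₀⟩ := hne
  refine le_csInf ⟨_, fun _ => π₀, fun _ => hπ₀, rfl⟩ ?_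
  rintro x ⟨w, hw, rfl⟩
  rcases le_or_gt N n with hN | hN
  · refine le_trans ?_ (h n hN hn h1 h3 w hw)
    gcongr
    exact min_le_left _ _
  · simp only [kappa1, not_forall, not_not] at h1
    obtain ⟨P, hP⟩ := h1
    calc min c (ε ^ N) * (n : ℝ) ^ (-(1 : ℝ) / 2) ≤ ε ^ N * 1 := by
          gcongr
          · exact min_le_right _ _
          · exact rpow_neg_half_le_one hn
      _ ≤ ε ^ n := by rw [mul_one]; exact pow_le_pow_of_le_one hε.le hε1 hN.le
      _ = ∏ _j : Fin n, ε := by simp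
      _ ≤ ∏ j, w j (P j) := Finset.prod_le_prod (fun _ _ => hε.le) fun j _ => hεD _ (hw j) _
      _ = prodMass w {P} := by simp [prodMass]
      _ ≤ probParadox p n f q d w :=
          prodMass_le_probParadox (fun j ω => hε.le.trans (hεD _ (hw j) ω)) (by simpa using hP)

/-- If every inconsistent outcome that weakly agrees with a distribution in the convex hull can be
approached along one of finitely many directions, then paradoxes have probability bounded below. -/
theorem exists_le_probParadox_of_directions (hsp : StrictlyPositive p D)
    (hdist : ∀ π ∈ D, IsDistribution p π) {κ : Type*} [Fintype κ] (v : κ → Judg p → ℝ)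
    (hv : ∀ β, ∑ ω, v β ω = 0) {η : ℝ} (hη : 0 < η)
    (hdir : ∀ π ∈ convexHull ℝ D, ∀ α, ¬ Consistent p f α →
      (∀ i, 0 ≤ sgn (α i) * (pr p f π i - q i)) →
      ∃ β, ∀ i, 1 ≤ sgn (α i) * pr p f (v β) i ∨ η ≤ |pr p f π i - q i|) :
    EventualParadoxBound p f q d D := by
  obtain ⟨ε, hε, hεD⟩ := hsp
  set B := ∑ β, ∑ ω, |v β ω| with hB
  have hvB : ∀ β ω, |v β ω| ≤ B := fun β ω =>
    (Finset.single_le_sum (f := fun ω => |v β ω|) (fun _ _ => abs_nonneg _)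
      (Finset.mem_univ ω)).trans
    (Finset.single_le_sum (f := fun β => ∑ ω, |v β ω|)
      (fun _ _ => Finset.sum_nonneg fun _ _ => abs_nonneg _) (Finset.mem_univ β))
  obtain ⟨c, hc, N, h⟩ := exists_le_prodMass_quota_eq p f q d hε hη
    (B := B) (Finset.sum_nonneg fun _ _ => Finset.sum_nonneg fun _ _ => abs_nonneg _)
  refine ⟨c, hc, N, fun n hN hn _ h3 w hw => ?_⟩
  have hmem := average_mem_convexHull hn hw
  simp only [kappa3, not_exists, not_and, not_forall] at h3
  obtain ⟨α, ⟨hα, -⟩, hcons⟩ := h3 _ hmem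
  obtain ⟨β, hβ⟩ := hdir _ hmem α hcons hα.sgn_mul_nonneg
  calc c * (n : ℝ) ^ (-(1 : ℝ) / 2) ≤ c := mul_le_of_le_one_right hc.le (rpow_neg_half_le_one hn)
    _ ≤ _ := h n hN w (fun j => (hdist _ (hw j)).2) (fun j => hεD _ (hw j)) (v β) (hv β) (hvB β) α
        hα.sgn_mul_nonneg hβ
    _ ≤ _ := prodMass_le_probParadox (fun j ω => hε.le.trans (hεD _ (hw j) ω)) (by
        intro P hP
        simp only [Finset.mem_filter, Finset.mem_univ, true_and] at hP
        rwa [Paradox, hP])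

theorem exists_le_probParadox_of_affineDefect_ne_zero (hsp : StrictlyPositive p D)
    (hdist : ∀ π ∈ D, IsDistribution p π) {ω₀ : Judg p} (h : affineDefect f ω₀ ≠ 0) :
    EventualParadoxBound p f q d D := by
  choose v hv0 hv using fun α : Fin (p + 1) → Bool =>
    exists_direction_of_affineDefect_ne_zero h fun i => sgn (α i)
  refine exists_le_probParadox_of_directions hsp hdist v hv0 one_pos fun π _ α _ _ =>
    ⟨α, fun i => Or.inl ?_⟩
  rw [hv, sgn_mul_self]

theorem exists_le_probParadox_of_const (hdist : ∀ π ∈ D, IsDistribution p π) {b : Bool}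
    (hf : ∀ ω, f ω = b) :
    EventualParadoxBound p f q d D := by
  refine ⟨1, one_pos, 0, fun n _ hn h1 _ w hw => ?_⟩
  simp only [kappa1, not_forall, not_not] at h1
  obtain ⟨P₀, hP₀⟩ := h1
  have hcount : ∀ P : Fin n → Judg p, nOnes p n f P (Fin.last p) = nOnes p n f P₀ (Fin.last p) := by
    intro P
    cases b <;> simp [nOnes_eq_card, Omega, hf]
  rw [one_mul]
  refine (rpow_neg_half_le_one hn).trans ?_
  rw [← prodMass_univ w fun j => (hdist _ (hw j)).2]
  refine prodMass_le_probParadox (fun j => (hdist _ (hw j)).1) fun P _ => ?_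
  simp only [Paradox, Consistent, hf, quota] at hP₀ ⊢
  rwa [hcount P]

theorem exists_le_probParadox_of_xor_of_ne (hsp : StrictlyPositive p D)
    (hdist : ∀ π ∈ D, IsDistribution p π) {k : Fin p} {b : Bool}
    (hf : ∀ ω, f ω = (b ^^ ω k)) (hq : q (Fin.last p) ≠ bval b - sgn b * q k.castSucc) :
    EventualParadoxBound p f q d D := by
  set δ := q (Fin.last p) - (bval b - sgn b * q k.castSucc) with hδ
  have hδ0 : 0 < |δ| := abs_pos.2 (sub_ne_zero.2 hq)
  refine exists_le_probParadox_of_directions hsp hdist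
    (fun β : Fin p → Bool => premiseDir fun i => sgn (β i)) (fun β => sum_premiseDir _)
    (half_pos hδ0) fun π hπ α hα hx => ?_
  have hs := sgn_last_of_not_consistent hf hα
  have hprem : ∀ (β : Fin p → Bool) (i : Fin p),
      pr p f (premiseDir fun i => sgn (β i)) i.castSucc = sgn (β i) := by
    intro β i
    rw [pr_castSucc, sum_premiseDir_mul_bval]
  have hlast : ∀ β : Fin p → Bool,
      pr p f (premiseDir fun i => sgn (β i)) (Fin.last p) = -(sgn b * sgn (β k)) := by
    intro β
    rw [pr_last_of_xor hf, sum_premiseDir, hprem]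
    ring
  have hgap : pr p f π (Fin.last p) - q (Fin.last p) =
      -(sgn b * (pr p f π k.castSucc - q k.castSucc)) - δ := by
    rw [pr_last_of_xor hf, sum_eq_one_of_mem_convexHull hdist hπ, hδ]
    ring
  rcases le_or_gt (|δ| / 2) |pr p f π k.castSucc - q k.castSucc| with hk | hk
  · refine ⟨Function.update (fun i => α i.castSucc) k (!α k.castSucc), fun i => ?_⟩
    refine Fin.lastCases ?_ (fun j => ?_) i
    · left
      rw [hlast, Function.update_self, hs, sgn_not]
      apply le_of_eq
      linear_combination (-(sgn b * sgn b)) * sgn_mul_self (α k.castSucc) - sgn_mul_self b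
    · rcases eq_or_ne j k with rfl | hj
      · exact Or.inr hk
      · left
        rw [hprem, Function.update_of_ne hj, sgn_mul_self]
  · refine ⟨fun i => α i.castSucc, fun i => ?_⟩
    refine Fin.lastCases (Or.inr ?_) (fun j => Or.inl ?_) i
    · have h1 : |δ| ≤ |pr p f π (Fin.last p) - q (Fin.last p)| +
          |pr p f π k.castSucc - q k.castSucc| := by
        have : δ = -(pr p f π (Fin.last p) - q (Fin.last p)) +
            -(sgn b * (pr p f π k.castSucc - q k.castSucc)) := by rw [hgap]; ring
        calc |δ| ≤ _ := this ▸ abs_add_le _ _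
          _ = _ := by rw [abs_neg, abs_neg, abs_mul, abs_sgn, one_mul]
      linarith
    · rw [hprem, sgn_mul_self]

/-- If the conclusion copies or negates a premise with matching thresholds, opposite weak
inequalities for the two propositions force a tie. -/
theorem tie_of_xor {α : Fin (p + 1) → Bool} {k : Fin p} {b : Bool} (x y : ℝ)
    (hs : sgn (α (Fin.last p)) = sgn b * sgn (α k.castSucc))
    (hxy : y = -(sgn b * x)) (hx : 0 ≤ sgn (α k.castSucc) * x)
    (hy : 0 ≤ sgn (α (Fin.last p)) * y) : x = 0 := by
  have h1 : sgn (α (Fin.last p)) * y = -(sgn (α k.castSucc) * x) := by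
    rw [hs, hxy]
    linear_combination (-(sgn (α k.castSucc) * x)) * sgn_mul_self b
  have h2 : sgn (α k.castSucc) * x = 0 := by linarith
  have h3 : |sgn (α k.castSucc) * x| = 0 := by rw [h2, abs_zero]
  rwa [abs_mul, abs_sgn, one_mul, abs_eq_zero] at h3

theorem exists_le_probParadox_of_xor_of_eq (hne : D.Nonempty) (hsp : StrictlyPositive p D)
    (hdist : ∀ π ∈ D, IsDistribution p π) {k : Fin p} {b : Bool}
    (hf : ∀ ω, f ω = (b ^^ ω k)) (hq : q (Fin.last p) = bval b - sgn b * q k.castSucc) :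
    EventualParadoxBound p f q d D := by
  refine ⟨Real.exp (-2), Real.exp_pos _, 0, fun n _ hn h1 h3 w hw => ?_⟩
  simp only [kappa3, not_exists, not_and, not_forall] at h3
  simp only [kappa1, not_forall, not_not] at h1
  have hprq : ∀ π ∈ D, pr p f π k.castSucc = q k.castSucc := by
    intro π hπ
    obtain ⟨α, ⟨hα, -⟩, hcons⟩ := h3 π (subset_convexHull ℝ D hπ)
    refine sub_eq_zero.1 (tie_of_xor _ _ (sgn_last_of_not_consistent hf hcons) ?_
      (hα.sgn_mul_nonneg _) (hα.sgn_mul_nonneg _))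
    rw [pr_last_of_xor hf, (hdist π hπ).2, hq]
    ring
  have hcount : ∀ P : Fin n → Judg p, (nOnes p n f P (Fin.last p) : ℝ) - q (Fin.last p) * n =
      -(sgn b * ((nOnes p n f P k.castSucc : ℝ) - q k.castSucc * n)) := by
    intro P
    rw [nOnes_eq_pr, nOnes_eq_pr, pr_last_of_xor hf, sum_HistR, hq]
    ring
  have htie : ∀ P : Fin n → Judg p, (nOnes p n f P k.castSucc : ℝ) = q k.castSucc * n →
      quota p n f q d P k.castSucc = d k.castSucc ∧
        quota p n f q d P (Fin.last p) = d (Fin.last p) := by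
    intro P hP
    have := hcount P
    rw [hP, sub_self, mul_zero, neg_zero, sub_eq_zero] at this
    simp [quota, hP, this]
  obtain ⟨P₀, hP₀⟩ := h1
  have hm : (nOnes p n f P₀ k.castSucc : ℝ) = q k.castSucc * n :=
    sub_eq_zero.1 (tie_of_xor _ _ (sgn_last_of_not_consistent hf hP₀) (hcount P₀)
      (sgn_quota_mul_nonneg _ _) (sgn_quota_mul_nonneg _ _))
  obtain ⟨π, hπ⟩ := hne
  obtain ⟨ε, hε, hεD⟩ := hsp
  have hsum : ∑ ω, π ω * bval (ω k) = q k.castSucc := by rw [← hprq π hπ, pr_castSucc]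
  have hpos : ∀ ω, 0 < π ω := fun ω => hε.trans_le (hεD π hπ ω)
  have hq0 : 0 < q k.castSucc := by
    rw [← hsum]
    refine Finset.sum_pos' (fun ω _ => mul_nonneg (hpos ω).le ?_) ⟨fun _ => true, by simp, ?_⟩
    · unfold bval; split_ifs <;> norm_num
    · simpa [bval] using hpos _
  have hq1 : q k.castSucc < 1 := by
    rw [← hsum, ← (hdist π hπ).2]
    refine Finset.sum_lt_sum (fun ω _ => mul_le_of_le_one_right (hpos ω).le ?_)
      ⟨zeroJudg, by simp, ?_⟩
    · unfold bval; split_ifs <;> norm_num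
    · simpa [bval, zeroJudg] using hpos _
  have hmn : nOnes p n f P₀ k.castSucc ≤ Fintype.card (Fin n) := by
    rw [nOnes_eq_card]
    exact Finset.card_le_univ _
  have hbin := prodMass_card_filter_eq (Omega p f k.castSucc) w hq0
    (fun j => (hdist _ (hw j)).2) (fun j => hprq _ (hw j)) _ hmn
  rw [Fintype.card_fin] at hbin
  calc Real.exp (-2) * (n : ℝ) ^ (-(1 : ℝ) / 2) = Real.exp (-2) * (√n)⁻¹ := by
        rw [neg_div, Real.rpow_neg (by positivity), Real.sqrt_eq_rpow]
    _ ≤ _ := inv_sqrt_le_binomial_mean hq0 hq1 (by omega) hm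
    _ = _ := hbin.symm
    _ ≤ _ := prodMass_le_probParadox (fun j => (hdist _ (hw j)).1) ?_
  intro P hP
  simp only [Finset.mem_filter, Finset.mem_univ, true_and, ← nOnes_eq_card] at hP
  have h := htie P (by rw [hP, hm])
  have h₀ := htie P₀ hm
  simp only [Paradox, Consistent, hf] at hP₀ ⊢
  rwa [h.1, h.2, ← h₀.1, ← h₀.2]

end LowerBound

/-- there is `c > 0` such that whenever κ1(n) and κ3(n) both fail,
`DP^min(n) ≥ c·n^{−1/2}`. -/
theorem stmt_18 (p : ℕ) (hp : 1 ≤ p) (f : Judg p → Bool)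
    (q : Fin (p + 1) → ℝ) (hq : ∀ i, q i ∈ Set.Icc (0 : ℝ) 1)
    (d : Fin (p + 1) → Bool) (D : Set (Judg p → ℝ)) (hne : D.Nonempty)
    (hcl : IsClosed D) (hsp : StrictlyPositive p D)
    (hdist : ∀ π ∈ D, IsDistribution p π) :
    ∃ c > (0 : ℝ), ∀ n : ℕ, 1 ≤ n → ¬ kappa1 p n f q d → ¬ kappa3 p n f q d D →
      c * (n : ℝ) ^ (-(1 : ℝ) / 2) ≤ DPmin p n f q d D := by
  refine exists_le_DPmin_of_eventually hne hsp hdist ?_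
  by_cases h : ∃ ω₀, affineDefect f ω₀ ≠ 0
  · obtain ⟨ω₀, h⟩ := h
    exact exists_le_probParadox_of_affineDefect_ne_zero hsp hdist h
  · push Not at h
    rcases const_or_xor_of_affineDefect_eq_zero h with ⟨b, hf⟩ | ⟨k, b, hf⟩
    · exact exists_le_probParadox_of_const hdist hf
    · by_cases hqk : q (Fin.last p) = bval b - sgn b * q k.castSucc
      · exact exists_le_probParadox_of_xor_of_eq hne hsp hdist hf hqk
      · exact exists_le_probParadox_of_xor_of_ne hsp hdist hf hqk

end
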